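/- Let M₀ be the right 𝓑-module ι_c𝓑 ⊕ ι_a𝓑 ⊕ ι_b𝓑 ⊕ ι_b𝓑, with generators x_c, x_a, x_b, x_{b'} (the idempotents ι_c, ι_a, ι_b, ι_b in the respective summands), equipped with the unique right-𝓑-linear endomorphism ∂ satisfying ∂x_c = x_b·q₂q₁q₄ + x_a·(p₂p₃ + q₁q₄), ∂x_a = x_{b'}·q₂, ∂x_b = x_{b'}, ∂x_{b'} = 0. Let N₀ be the right 𝓑-module ι_c𝓑 ⊕ ι_a𝓑 with generators y_c, y_a and the unique right-𝓑-linear endomorphism ∂ satisfying ∂y_c = y_a·(p₂p₃ + q₁q₄), ∂y_a = 0. Then (M₀, ∂) and (N₀, ∂) are differential modules over 𝓑 (i.e. ∂ ∘ ∂ = 0 in both), and they are homotopy equivalent. -/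

import Mathlib

/-- The field with two elements. -/
abbrev F2 := ZMod 2

/-- Generators of the peculiar algebra `𝓑`: the idempotents `ι_a, ι_b, ι_c, ι_d`
and the arrows `p₁, p₂, p₃, q₁, q₂, q₄`. -/
inductive BGen : Type
  | ia : BGen
  | ib : BGen
  | ic : BGen
  | id : BGen
  | p1 : BGen
  | p2 : BGen
  | p3 : BGen
  | q1 : BGen
  | q2 : BGen
  | q4 : BGen

/-- The free `𝔽₂`-algebra on the generators. -/
abbrev FB := FreeAlgebra F2 BGen

/-- The generators, as elements of the free algebra. -/
def gB : BGen → FB := FreeAlgebra.ι F2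

/-- The four idempotent generators. -/
def eGen : Fin 4 → BGen := ![.ia, .ib, .ic, .id]

/-- The defining relations of the peculiar algebra `𝓑`: `ι_a, ι_b, ι_c, ι_d` are
pairwise orthogonal idempotents summing to `1`; `p₁ = ι_d p₁ ι_a`,
`q₁ = ι_a q₁ ι_d`, `p₂ = ι_a p₂ ι_b`, `q₂ = ι_b q₂ ι_a`, `p₃ = ι_b p₃ ι_c`,
`q₄ = ι_d q₄ ι_c`; and `p₁q₁ = q₁p₁ = p₂q₂ = q₂p₂ = 0`. -/
inductive BRel : FB → FB → Prop
  | idem (i : Fin 4) : BRel (gB (eGen i) * gB (eGen i)) (gB (eGen i))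
  | orth (i j : Fin 4) (h : i ≠ j) : BRel (gB (eGen i) * gB (eGen j)) 0
  | sum_idem : BRel (gB .ia + gB .ib + gB .ic + gB .id) 1
  | sand_p1 : BRel (gB .p1) (gB .id * gB .p1 * gB .ia)
  | sand_q1 : BRel (gB .q1) (gB .ia * gB .q1 * gB .id)
  | sand_p2 : BRel (gB .p2) (gB .ia * gB .p2 * gB .ib)
  | sand_q2 : BRel (gB .q2) (gB .ib * gB .q2 * gB .ia)
  | sand_p3 : BRel (gB .p3) (gB .ib * gB .p3 * gB .ic)
  | sand_q4 : BRel (gB .q4) (gB .id * gB .q4 * gB .ic)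
  | p1q1 : BRel (gB .p1 * gB .q1) 0
  | q1p1 : BRel (gB .q1 * gB .p1) 0
  | p2q2 : BRel (gB .p2 * gB .q2) 0
  | q2p2 : BRel (gB .q2 * gB .p2) 0

/-- The peculiar algebra `𝓑`, presented by generators and relations. -/
abbrev PeculiarAlgebra := RingQuot BRel

/-- The quotient map onto the peculiar algebra. -/
def mkB : FB →ₐ[F2] PeculiarAlgebra := RingQuot.mkAlgHom F2 BRel

open MulOpposite

/-- Short name for the opposite algebra: scalars for *right* `𝓑`-modules. -/
abbrev Bop := PeculiarAlgebraᵐᵒᵖ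

/-- The idempotents `ι_a, ι_b, ι_c, ι_d` of `𝓑`. -/
def ea : PeculiarAlgebra := mkB (gB .ia)
def eb : PeculiarAlgebra := mkB (gB .ib)
def ec : PeculiarAlgebra := mkB (gB .ic)
def ed : PeculiarAlgebra := mkB (gB .id)

/-- The arrows `p₁, p₂, p₃, q₁, q₂, q₄` of `𝓑`. -/
def pe1 : PeculiarAlgebra := mkB (gB .p1)
def pe2 : PeculiarAlgebra := mkB (gB .p2)
def pe3 : PeculiarAlgebra := mkB (gB .p3)
def qe1 : PeculiarAlgebra := mkB (gB .q1)
def qe2 : PeculiarAlgebra := mkB (gB .q2)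
def qe4 : PeculiarAlgebra := mkB (gB .q4)

lemma idemSq (i : Fin 4) :
    mkB (gB (eGen i)) * mkB (gB (eGen i)) = mkB (gB (eGen i)) := by
  rw [← map_mul]; exact RingQuot.mkAlgHom_rel F2 (BRel.idem i)

/-- The right ideal `e𝓑 = {x | e·x = x}` (for `e` idempotent), as a right
`𝓑`-submodule of `𝓑`, i.e. a submodule for the `𝓑ᵐᵒᵖ`-action `b • x = x * b`. -/
def rId (e : PeculiarAlgebra) : Submodule Bop PeculiarAlgebra where
  carrier := {x | e * x = x}
  add_mem' := by
    intro x y hx hy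
    simp only [Set.mem_setOf_eq] at *
    rw [mul_add, hx, hy]
  zero_mem' := by simp
  smul_mem' := by
    intro c x hx
    simp only [Set.mem_setOf_eq, MulOpposite.smul_eq_mul_unop] at *
    rw [← mul_assoc, hx]

lemma mem_rId {e x : PeculiarAlgebra} : x ∈ rId e ↔ e * x = x := Iff.rfl

lemma ea_mem : ea ∈ rId ea := idemSq 0
lemma eb_mem : eb ∈ rId eb := idemSq 1
lemma ec_mem : ec ∈ rId ec := idemSq 2
lemma ed_mem : ed ∈ rId ed := idemSq 3

/-- Homotopy equivalence of differential right `𝓑`-modules `(M, dM)` and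
`(N, dN)`: there are right-`𝓑`-linear maps `f : M → N` and `g : N → M`
commuting with the differentials, and right-`𝓑`-linear homotopies `h`, `k`
with `g ∘ f = id + dM∘h + h∘dM` and `f ∘ g = id + dN∘k + k∘dN`. -/
def IsHtpyEquiv {M N : Type} [AddCommGroup M] [AddCommGroup N]
    [Module Bop M] [Module Bop N]
    (dM : M →ₗ[Bop] M) (dN : N →ₗ[Bop] N) : Prop :=
  ∃ (f : M →ₗ[Bop] N) (g : N →ₗ[Bop] M) (h : M →ₗ[Bop] M) (k : N →ₗ[Bop] N),
    f ∘ₗ dM = dN ∘ₗ f ∧ g ∘ₗ dN = dM ∘ₗ g ∧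
    g ∘ₗ f = LinearMap.id + dM ∘ₗ h + h ∘ₗ dM ∧
    f ∘ₗ g = LinearMap.id + dN ∘ₗ k + k ∘ₗ dN

/-- The right `𝓑`-module `M₀ = ι_c𝓑 ⊕ ι_a𝓑 ⊕ ι_b𝓑 ⊕ ι_b𝓑`. -/
abbrev M0 := ↥(rId ec) × ↥(rId ea) × ↥(rId eb) × ↥(rId eb)

/-- The generators `x_c, x_a, x_b, x_{b'}` of `M₀` (the idempotents
`ι_c, ι_a, ι_b, ι_b` in the respective summands). -/
def xc : M0 := (⟨ec, ec_mem⟩, 0, 0, 0)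
def xa : M0 := (0, ⟨ea, ea_mem⟩, 0, 0)
def xb : M0 := (0, 0, ⟨eb, eb_mem⟩, 0)
def xb' : M0 := (0, 0, 0, ⟨eb, eb_mem⟩)

/-- The defining conditions on the differential of `M₀`:
`∂x_c = x_b·q₂q₁q₄ + x_a·(p₂p₃ + q₁q₄)`, `∂x_a = x_{b'}·q₂`, `∂x_b = x_{b'}`,
`∂x_{b'} = 0` (right action written as `op β • x = x·β`). -/
def condM0 (d : M0 →ₗ[Bop] M0) : Prop :=
  d xc = op (qe2 * qe1 * qe4) • xb + op (pe2 * pe3 + qe1 * qe4) • xa ∧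
  d xa = op qe2 • xb' ∧
  d xb = xb' ∧
  d xb' = 0

/-- The right `𝓑`-module `N₀ = ι_c𝓑 ⊕ ι_a𝓑`. -/
abbrev N0 := ↥(rId ec) × ↥(rId ea)

/-- The generators `y_c, y_a` of `N₀`. -/
def yc : N0 := (⟨ec, ec_mem⟩, 0)
def ya : N0 := (0, ⟨ea, ea_mem⟩)

/-- The defining conditions on the differential of `N₀`:
`∂y_c = y_a·(p₂p₃ + q₁q₄)`, `∂y_a = 0`. -/
def condN0 (d : N0 →ₗ[Bop] N0) : Prop :=
  d yc = op (pe2 * pe3 + qe1 * qe4) • ya ∧ d ya = 0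

lemma brel {x y : FB} (h : BRel x y) : mkB x = mkB y := RingQuot.mkAlgHom_rel F2 h

lemma q2p2z : qe2 * pe2 = 0 := by
  have h := brel BRel.q2p2
  rw [map_mul, map_zero] at h
  exact h

lemma eb_q2 : eb * qe2 = qe2 := by
  have h : qe2 = eb * qe2 * ea := by
    have h := brel BRel.sand_q2
    rw [map_mul, map_mul] at h
    exact h
  have hb : eb * eb = eb := idemSq 1
  rw [h, ← mul_assoc, ← mul_assoc, hb]

lemma q2_ea : qe2 * ea = qe2 := by
  have h : qe2 = eb * qe2 * ea := by
    have h := brel BRel.sand_q2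
    rw [map_mul, map_mul] at h
    exact h
  have hb : ea * ea = ea := idemSq 0
  rw [h, mul_assoc, hb]

lemma p3_ec : pe3 * ec = pe3 := by
  have h : pe3 = eb * pe3 * ec := by
    have h := brel BRel.sand_p3
    rw [map_mul, map_mul] at h
    exact h
  have hb : ec * ec = ec := idemSq 2
  rw [h, mul_assoc, hb]

lemma q4_ec : qe4 * ec = qe4 := by
  have h : qe4 = ed * qe4 * ec := by
    have h := brel BRel.sand_q4
    rw [map_mul, map_mul] at h
    exact h
  have hb : ec * ec = ec := idemSq 2
  rw [h, mul_assoc, hb]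

lemma addself (x : PeculiarAlgebra) : x + x = 0 := by
  have : (2 : F2) • x = 0 := by
    rw [show (2 : F2) = 0 from rfl, zero_smul]
  rwa [two_smul] at this

lemma addselfM {M : Type} [AddCommMonoid M] [Module Bop M] (x : M) : x + x = 0 := by
  have h : (op ((1 : PeculiarAlgebra) + 1)) • x = 0 := by
    rw [addself, op_zero, zero_smul]
  rwa [op_add, op_one, add_smul, one_smul] at h

/-- the map `e𝓑 → M` sending `x` to `m·x` -/
def liftE {M : Type} [AddCommMonoid M] [Module Bop M] (e : PeculiarAlgebra) (m : M) :
    ↥(rId e) →ₗ[Bop] M where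
  toFun x := op (x : PeculiarAlgebra) • m
  map_add' x y := by simp [add_smul]
  map_smul' c x := by
    simp [smul_smul, MulOpposite.smul_eq_mul_unop]

lemma liftE_apply {M : Type} [AddCommMonoid M] [Module Bop M] (e : PeculiarAlgebra) (m : M)
    (x : ↥(rId e)) : liftE e m x = op (x : PeculiarAlgebra) • m := rfl

lemma existsM {M : Type} [AddCommMonoid M] [Module Bop M] (mc ma mb mb' : M)
    (hc : op ec • mc = mc) (ha : op ea • ma = ma) (hb : op eb • mb = mb)
    (hb' : op eb • mb' = mb') :
    ∃ φ : M0 →ₗ[Bop] M, φ xc = mc ∧ φ xa = ma ∧ φ xb = mb ∧ φ xb' = mb' := by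
  refine ⟨(liftE ec mc).coprod ((liftE ea ma).coprod ((liftE eb mb).coprod (liftE eb mb'))),
    ?_, ?_, ?_, ?_⟩ <;>
  simp [xc, xa, xb, xb', liftE_apply, hc, ha, hb, hb']

lemma existsN {M : Type} [AddCommMonoid M] [Module Bop M] (mc ma : M)
    (hc : op ec • mc = mc) (ha : op ea • ma = ma) :
    ∃ φ : N0 →ₗ[Bop] M, φ yc = mc ∧ φ ya = ma := by
  refine ⟨(liftE ec mc).coprod (liftE ea ma), ?_, ?_⟩ <;>
  simp [yc, ya, liftE_apply, hc, ha]

lemma decompM (z : M0) : z = op (z.1 : PeculiarAlgebra) • xc + op (z.2.1 : PeculiarAlgebra) • xa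
    + op (z.2.2.1 : PeculiarAlgebra) • xb + op (z.2.2.2 : PeculiarAlgebra) • xb' := by
  obtain ⟨⟨a, ha⟩, ⟨b, hb⟩, ⟨c, hc⟩, ⟨d, hd⟩⟩ := z
  rw [mem_rId] at ha hb hc hd
  ext <;> simp [xc, xa, xb, xb', ha, hb, hc, hd]

lemma decompN (z : N0) : z = op (z.1 : PeculiarAlgebra) • yc
    + op (z.2 : PeculiarAlgebra) • ya := by
  obtain ⟨⟨a, ha⟩, ⟨b, hb⟩⟩ := z
  rw [mem_rId] at ha hb
  ext <;> simp [yc, ya, ha, hb]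

lemma extM {M : Type} [AddCommMonoid M] [Module Bop M] (φ ψ : M0 →ₗ[Bop] M)
    (hc : φ xc = ψ xc) (ha : φ xa = ψ xa) (hb : φ xb = ψ xb) (hb' : φ xb' = ψ xb') : φ = ψ := by
  apply LinearMap.ext
  intro z
  rw [decompM z]
  simp only [map_add, map_smul, hc, ha, hb, hb']

lemma extN {M : Type} [AddCommMonoid M] [Module Bop M] (φ ψ : N0 →ₗ[Bop] M)
    (hc : φ yc = ψ yc) (ha : φ ya = ψ ya) : φ = ψ := by
  apply LinearMap.ext
  intro z
  rw [decompN z]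
  simp only [map_add, map_smul, hc, ha]

lemma xc_e : op ec • xc = xc := by
  have h : ec * ec = ec := idemSq 2
  ext <;> simp [xc, h]
lemma xa_e : op ea • xa = xa := by
  have h : ea * ea = ea := idemSq 0
  ext <;> simp [xa, h]
lemma xb_e : op eb • xb = xb := by
  have h : eb * eb = eb := idemSq 1
  ext <;> simp [xb, h]
lemma xb'_e : op eb • xb' = xb' := by
  have h : eb * eb = eb := idemSq 1
  ext <;> simp [xb', h]
lemma yc_e : op ec • yc = yc := by
  have h : ec * ec = ec := idemSq 2
  ext <;> simp [yc, h]
lemma ya_e : op ea • ya = ya := by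
  have h : ea * ea = ea := idemSq 0
  ext <;> simp [ya, h]

lemma D_ec : (pe2 * pe3 + qe1 * qe4) * ec = pe2 * pe3 + qe1 * qe4 := by
  rw [add_mul, mul_assoc, mul_assoc, p3_ec, q4_ec]

lemma q2D : qe2 * (pe2 * pe3 + qe1 * qe4) = qe2 * qe1 * qe4 := by
  rw [mul_add, ← mul_assoc, q2p2z, zero_mul, zero_add, mul_assoc]

lemma ss {M : Type} [AddCommMonoid M] [Module Bop M] (a b : PeculiarAlgebra) (m : M) :
    op a • op b • m = op (b * a) • m := by
  rw [smul_smul, op_mul]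


/-- There is a unique right-`𝓑`-linear endomorphism `∂` of `M₀` with
`∂x_c = x_b·q₂q₁q₄ + x_a·(p₂p₃ + q₁q₄)`, `∂x_a = x_{b'}·q₂`, `∂x_b = x_{b'}`,
`∂x_{b'} = 0`, and a unique right-`𝓑`-linear endomorphism `∂` of `N₀` with
`∂y_c = y_a·(p₂p₃ + q₁q₄)`, `∂y_a = 0`; both are differentials (`∂ ∘ ∂ = 0`),
and the resulting differential modules `(M₀, ∂)` and `(N₀, ∂)` are homotopy
equivalent. -/
theorem stmt_8 :
    (∃! dM : M0 →ₗ[Bop] M0, condM0 dM) ∧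
    (∃! dN : N0 →ₗ[Bop] N0, condN0 dN) ∧
    ∀ (dM : M0 →ₗ[Bop] M0) (dN : N0 →ₗ[Bop] N0), condM0 dM → condN0 dN →
      dM ∘ₗ dM = 0 ∧ dN ∘ₗ dN = 0 ∧ IsHtpyEquiv (M := M0) (N := N0) dM dN := by
  refine ⟨?_, ?_, ?_⟩
  · obtain ⟨φ, h1, h2, h3, h4⟩ := existsM
      (op (qe2 * qe1 * qe4) • xb + op (pe2 * pe3 + qe1 * qe4) • xa) (op qe2 • xb') xb' 0
      (by rw [smul_add, ss, ss, D_ec, mul_assoc, q4_ec]) (by rw [ss, q2_ea]) xb'_e (smul_zero _)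
    refine ⟨φ, ⟨h1, h2, h3, h4⟩, ?_⟩
    rintro ψ ⟨k1, k2, k3, k4⟩
    exact extM _ _ (k1.trans h1.symm) (k2.trans h2.symm) (k3.trans h3.symm) (k4.trans h4.symm)
  · obtain ⟨φ, h1, h2⟩ := existsN (op (pe2 * pe3 + qe1 * qe4) • ya) 0
      (by rw [ss, D_ec]) (smul_zero _)
    refine ⟨φ, ⟨h1, h2⟩, ?_⟩
    rintro ψ ⟨k1, k2⟩
    exact extN _ _ (k1.trans h1.symm) (k2.trans h2.symm)
  · rintro dM dN ⟨d1, d2, d3, d4⟩ ⟨e1, e2⟩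
    refine ⟨?_, ?_, ?_⟩
    · apply extM
      · simp only [LinearMap.comp_apply, LinearMap.zero_apply, d1, d2, d3, map_add, map_smul, ss,
          q2D, addselfM]
      · simp only [LinearMap.comp_apply, LinearMap.zero_apply, d2, d4, map_smul, smul_zero]
      · simp only [LinearMap.comp_apply, LinearMap.zero_apply, d3, d4]
      · simp only [LinearMap.comp_apply, LinearMap.zero_apply, d4, map_zero]
    · apply extN
      · simp only [LinearMap.comp_apply, LinearMap.zero_apply, e1, e2, map_smul, smul_zero]
      · simp only [LinearMap.comp_apply, LinearMap.zero_apply, e2, map_zero]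
    · obtain ⟨f, f1, f2, f3, f4⟩ := existsM yc ya 0 0 yc_e ya_e (smul_zero _) (smul_zero _)
      obtain ⟨g, g1, g2⟩ := existsN xc (xa + op qe2 • xb) xc_e
        (by rw [smul_add, xa_e, ss, q2_ea])
      obtain ⟨h, h1, h2, h3, h4⟩ := existsM 0 0 0 xb (smul_zero _) (smul_zero _) (smul_zero _) xb_e
      refine ⟨f, g, h, 0, ?_, ?_, ?_, ?_⟩
      · apply extM <;>
        simp only [LinearMap.comp_apply, d1, d2, d3, d4, e1, e2, f1, f2, f3, f4, map_add, map_smul,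
          map_zero, smul_zero, zero_add]
      · apply extN
        · simp only [LinearMap.comp_apply, d1, e1, g1, g2, map_smul, smul_add, ss, q2D]
          exact add_comm _ _
        · simp only [LinearMap.comp_apply, d2, d3, e2, g2, map_add, map_smul, map_zero, addselfM]
      · apply extM <;>
        simp only [LinearMap.comp_apply, LinearMap.add_apply, LinearMap.id_apply, d1, d2, d3, d4,
          f1, f2, f3, f4, g1, g2, h1, h2, h3, h4, map_add, map_smul,
          map_zero, smul_zero, zero_add, add_zero, addselfM]
      · apply extN <;>
        simp only [LinearMap.comp_apply, LinearMap.add_apply, LinearMap.id_apply,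
          LinearMap.zero_apply, f1, f2, f3, g1, g2, map_add, map_smul,
          map_zero, smul_zero, add_zero]
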